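/- Consider five positive masses m_1,…,m_5 and a nonsingular configuration q = (q_1,…,q_5) on S^3 ⊂ ℝ⁴ spanning ℝ⁴, with Δ_k = (−1)^{k+1} det(X_k) for X = [q_1,…,q_5]. Then q is a special central configuration if and only if: q_1,…,q_5 do not all lie in a common closed hemisphere (i.e. there is no unit vector u ∈ ℝ⁴ with u·q_i ≥ 0 for all i); the five shape equations sin d_13 · sin d_24 = sin d_14 · sin d_23, sin d_13 · sin d_25 = sin d_15 · sin d_23, sin d_24 · sin d_35 = sin d_34 · sin d_25, sin d_12 · sin d_34 = sin d_14 · sin d_23, and sin d_23 · sin d_45 = sin d_34 · sin d_25 hold; and the mass vector satisfies (m_1,…,m_5) = ( (sin³d_12 · Δ_1)/(sin³d_25 · Δ_5), (sin³d_12 · Δ_2)/(sin³d_15 · Δ_5), (sin³d_13 · Δ_3)/(sin³d_15 · Δ_5), (sin³d_14 · Δ_4)/(sin³d_15 · Δ_5), 1 ) · m_5. -/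

import Mathlib

open Real Matrix Finset

/-- The signed maximal minors of a `4 × 5` matrix are a relation between its columns. -/
lemma sum_minor_mul_eq_zero {R : Type*} [CommRing R] (X : Matrix (Fin 4) (Fin 5) R) (r : Fin 4) :
    ∑ k : Fin 5, (-1) ^ (k : ℕ) * (X.submatrix id (Fin.succAbove k)).det * X r k = 0 := by
  have h : (Matrix.of (Fin.cons (X r) X : Fin 5 → Fin 5 → R)).det = 0 :=
    Matrix.det_zero_of_row_eq (i := 0) (j := r.succ) (Fin.succ_ne_zero r).symm rfl
  rw [Matrix.det_succ_row_zero] at h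
  rw [← h]
  refine Finset.sum_congr rfl fun k _ => ?_
  have hs : (Matrix.of (Fin.cons (X r) X : Fin 5 → Fin 5 → R)).submatrix Fin.succ k.succAbove
      = X.submatrix id k.succAbove := by
    ext a b; rfl
  rw [hs, mul_right_comm]
  rfl

/-- A vector orthogonal to a spanning family vanishes. -/
lemma eq_zero_of_dotProduct_span {q : Fin 5 → Fin 4 → ℝ}
    (hspan : Submodule.span ℝ (Set.range q) = ⊤) {u : Fin 4 → ℝ} (hu : ∀ i, u ⬝ᵥ q i = 0) :
    u = 0 := by
  have hmem : ∀ x ∈ Submodule.span ℝ (Set.range q), u ⬝ᵥ x = 0 := by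
    intro x hx
    induction hx using Submodule.span_induction with
    | mem x h => obtain ⟨i, rfl⟩ := h; exact hu i
    | zero => simp
    | add x y _ _ hx hy => rw [dotProduct_add, hx, hy, add_zero]
    | smul a x _ hx => rw [dotProduct_smul, hx, smul_zero]
  exact dotProduct_self_eq_zero.1 (hmem u (hspan ▸ Submodule.mem_top))

/-- Deleting a column that occurs with nonzero coefficient in a relation between spanning columns
leaves an invertible matrix. -/
lemma minor_ne_zero_of_relation {q : Fin 5 → Fin 4 → ℝ}
    (hspan : Submodule.span ℝ (Set.range q) = ⊤)
    {X : Matrix (Fin 4) (Fin 5) ℝ} (hX : ∀ r c, X r c = q c r)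
    {a : Fin 5 → ℝ} (ha : ∑ k, a k • q k = 0) {j : Fin 5} (hj : a j ≠ 0) :
    (X.submatrix id (Fin.succAbove j)).det ≠ 0 := by
  intro hdet
  obtain ⟨u, hu0, hu⟩ := Matrix.exists_vecMul_eq_zero_iff.2 hdet
  have hne : ∀ k, u ⬝ᵥ q (j.succAbove k) = 0 := by
    intro k
    have := congrFun hu k
    simpa [Matrix.vecMul, dotProduct, hX] using this
  have h0 : ∑ k, a k * (u ⬝ᵥ q k) = 0 := by
    have := congrArg (fun x => u ⬝ᵥ x) ha
    simpa [dotProduct_sum, dotProduct_smul] using this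
  rw [Fin.sum_univ_succAbove _ j] at h0
  simp only [hne, mul_zero, Finset.sum_const_zero, add_zero, mul_eq_zero, hj, false_or] at h0
  refine hu0 (eq_zero_of_dotProduct_span hspan fun i => ?_)
  rcases Fin.eq_self_or_eq_succAbove j i with rfl | ⟨k, rfl⟩
  · exact h0
  · exact hne k

/-- Two relations between the columns of a `4 × 5` matrix are proportional when the matrix with
some column deleted is invertible. -/
lemma relation_proportional {q : Fin 5 → Fin 4 → ℝ}
    {X : Matrix (Fin 4) (Fin 5) ℝ} (hX : ∀ r c, X r c = q c r)
    {a b : Fin 5 → ℝ} (ha : ∑ k, a k • q k = 0) (hb : ∑ k, b k • q k = 0) {j : Fin 5}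
    (hdet : (X.submatrix id (Fin.succAbove j)).det ≠ 0) (k : Fin 5) :
    a j * b k = a k * b j := by
  have hc : ∑ k, (a j * b k - a k * b j) • q k = 0 := by
    calc ∑ k, (a j * b k - a k * b j) • q k
        = a j • ∑ k, b k • q k - b j • ∑ k, a k • q k := by
          rw [Finset.smul_sum, Finset.smul_sum, ← Finset.sum_sub_distrib]
          refine Finset.sum_congr rfl fun k _ => ?_
          module
      _ = 0 := by rw [ha, hb, smul_zero, smul_zero, sub_zero]
  rcases Fin.eq_self_or_eq_succAbove j k with rfl | ⟨l, rfl⟩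
  · ring
  rw [Fin.sum_univ_succAbove _ j, sub_self, zero_smul, zero_add] at hc
  have h0 := Matrix.eq_zero_of_mulVec_eq_zero hdet
    (v := fun l => a j * b (j.succAbove l) - a (j.succAbove l) * b j) (by
      ext r
      have := congrFun hc r
      simp only [Finset.sum_apply, Pi.smul_apply, smul_eq_mul, Pi.zero_apply] at this
      simp only [Matrix.mulVec, dotProduct, Matrix.submatrix_apply, id, hX, Pi.zero_apply]
      rw [← this]
      exact Finset.sum_congr rfl fun l _ => mul_comm _ _)
  exact sub_eq_zero.1 (congrFun h0 l)

/-- Unit vectors that are neither equal nor opposite have inner product in `(-1, 1)`. -/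
lemma one_sub_dotProduct_sq_pos {x y : Fin 4 → ℝ} (hx : x ⬝ᵥ x = 1) (hy : y ⬝ᵥ y = 1)
    (hne : x ≠ y) (hne' : x ≠ -y) : 0 < 1 - (x ⬝ᵥ y) ^ 2 := by
  have pos : ∀ z : Fin 4 → ℝ, z ≠ 0 → 0 < z ⬝ᵥ z := fun z hz =>
    lt_of_le_of_ne (Finset.sum_nonneg fun i _ => mul_self_nonneg _)
      (fun h => hz (dotProduct_self_eq_zero.1 h.symm))
  have h1 := pos (x - y) (sub_ne_zero.2 hne)
  have h2 := pos (x + y) (fun h => hne' (eq_neg_of_add_eq_zero_left h))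
  simp only [sub_dotProduct, dotProduct_sub, add_dotProduct, dotProduct_add, hx, hy,
    dotProduct_comm y x] at h1 h2
  nlinarith

/-- The equilibrium equation of one body, as a relation between all the positions. -/
lemma relation_of_equilibrium {q : Fin 5 → Fin 4 → ℝ} {w : Fin 5 → ℝ} {i : Fin 5}
    (h : ∑ j ∈ Finset.univ.erase i, w j • (q j - (q i ⬝ᵥ q j) • q i) = 0) :
    ∑ k, (if k = i then -∑ j ∈ Finset.univ.erase i, w j * (q i ⬝ᵥ q j) else w k) • q k = 0 := by
  rw [← Finset.add_sum_erase _ _ (Finset.mem_univ i), if_pos rfl]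
  have h' : ∑ k ∈ Finset.univ.erase i,
      (if k = i then -∑ j ∈ Finset.univ.erase i, w j * (q i ⬝ᵥ q j) else w k) • q k
      = ∑ k ∈ Finset.univ.erase i, w k • q k :=
    Finset.sum_congr rfl fun k hk => by rw [if_neg (Finset.ne_of_mem_erase hk)]
  rw [h', neg_smul, Finset.sum_smul, neg_add_eq_sub, ← Finset.sum_sub_distrib, ← h]
  exact Finset.sum_congr rfl fun k _ => by module

/-- A relation between the positions with weights `D` balances the tangential components at each
unit vector of the family. -/
lemma equilibrium_of_relation {q : Fin 5 → Fin 4 → ℝ} {D : Fin 5 → ℝ} (hD : ∑ k, D k • q k = 0)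
    {i : Fin 5} (hi : q i ⬝ᵥ q i = 1) :
    ∑ j ∈ Finset.univ.erase i, D j • (q j - (q i ⬝ᵥ q j) • q i) = 0 := by
  have h0 : ∑ j, D j * (q i ⬝ᵥ q j) = 0 := by
    have := congrArg (fun x => q i ⬝ᵥ x) hD
    simpa [dotProduct_sum, dotProduct_smul] using this
  rw [Finset.sum_erase _ (by rw [hi, one_smul, sub_self, smul_zero])]
  calc ∑ j, D j • (q j - (q i ⬝ᵥ q j) • q i)
      = ∑ j, D j • q j - (∑ j, D j * (q i ⬝ᵥ q j)) • q i := by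
        rw [Finset.sum_smul, ← Finset.sum_sub_distrib]
        exact Finset.sum_congr rfl fun k _ => by module
    _ = 0 := by rw [hD, h0, zero_smul, sub_zero]

/-- The shape equations follow from row-wise proportionality. -/
lemma shape_of_proportional {s : Fin 5 → Fin 5 → ℝ} (hs : ∀ i j, i ≠ j → 0 < s i j)
    (hsymm : ∀ i j, s i j = s j i) {t : Fin 5 → ℝ} (ht : ∀ i, t i ≠ 0)
    (h : ∀ i j k, j ≠ i → k ≠ i → t j * s i k ^ 3 = t k * s i j ^ 3)
    {a b c d : Fin 5} (hab : a ≠ b) (hac : a ≠ c) (hdb : d ≠ b) (hdc : d ≠ c) :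
    s a b * s c d = s a c * s b d := by
  have h1 := h a b c hab.symm hac.symm
  have h2 := h d b c hdb.symm hdc.symm
  rw [hsymm c d, hsymm b d]
  have := hs a b hab
  have := hs a c hac
  have := hs d b hdb
  have := hs d c hdc
  refine (pow_left_inj₀ (n := 3) (by positivity) (by positivity) (by norm_num)).1 ?_
  refine mul_left_cancel₀ (mul_ne_zero (ht b) (ht c)) ?_
  linear_combination -(t c * s d b ^ 3) * h1 + t c * s a b ^ 3 * h2

/-- The five shape equations and four mass ratios make the cubed sines a rank-one expression. -/
lemma rank_one_of_shape {s : Fin 5 → Fin 5 → ℝ} (hs : ∀ i j, i ≠ j → 0 < s i j)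
    (hsymm : ∀ i j, s i j = s j i) {t : Fin 5 → ℝ} (ht : ∀ i, t i ≠ 0)
    (e₁ : s 0 2 * s 1 3 = s 0 3 * s 1 2) (e₂ : s 0 2 * s 1 4 = s 0 4 * s 1 2)
    (e₃ : s 1 3 * s 2 4 = s 2 3 * s 1 4) (e₄ : s 0 1 * s 2 3 = s 0 3 * s 1 2)
    (e₅ : s 1 2 * s 3 4 = s 2 3 * s 1 4)
    (f₀ : t 0 * s 1 4 ^ 3 = s 0 1 ^ 3 * t 4) (f₁ : t 1 * s 0 4 ^ 3 = s 0 1 ^ 3 * t 4)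
    (f₂ : t 2 * s 0 4 ^ 3 = s 0 2 ^ 3 * t 4) (f₃ : t 3 * s 0 4 ^ 3 = s 0 3 ^ 3 * t 4) :
    ∃ κ : ℝ, κ ≠ 0 ∧ ∀ i j, i ≠ j → s i j ^ 3 = κ * t i * t j := by
  have cube : ∀ {a b c d : ℝ}, a * b = c * d → a ^ 3 * b ^ 3 = c ^ 3 * d ^ 3 := by
    intro a b c d h
    rw [← mul_pow, ← mul_pow, h]
  have ht0 := ht 0
  have ht1 := ht 1
  have ht2 := ht 2
  have ht3 := ht 3
  have ht4 := ht 4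
  have hr : s 0 4 ^ 3 ≠ 0 := (pow_pos (hs 0 4 (by decide)) 3).ne'
  obtain ⟨κ, hκ⟩ : ∃ κ, κ = s 0 4 ^ 3 / (t 0 * t 4) := ⟨_, rfl⟩
  have hκ0 : κ ≠ 0 := by rw [hκ]; exact div_ne_zero hr (mul_ne_zero ht0 ht4)
  have h04 : s 0 4 ^ 3 = κ * t 0 * t 4 := by rw [hκ]; field_simp
  have h01 : s 0 1 ^ 3 = κ * t 0 * t 1 :=
    mul_right_cancel₀ ht4 (by linear_combination -f₁ + t 1 * h04)
  have h02 : s 0 2 ^ 3 = κ * t 0 * t 2 :=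
    mul_right_cancel₀ ht4 (by linear_combination -f₂ + t 2 * h04)
  have h03 : s 0 3 ^ 3 = κ * t 0 * t 3 :=
    mul_right_cancel₀ ht4 (by linear_combination -f₃ + t 3 * h04)
  have h14 : s 1 4 ^ 3 = κ * t 1 * t 4 :=
    mul_left_cancel₀ ht0 (by linear_combination f₀ + t 4 * h01)
  have c₁ := cube e₁
  have c₂ := cube e₂
  have c₃ := cube e₃
  have c₄ := cube e₄
  have c₅ := cube e₅
  have h12 : s 1 2 ^ 3 = κ * t 1 * t 2 := by
    rw [h02, h14, h04] at c₂
    exact mul_left_cancel₀ (mul_ne_zero (mul_ne_zero hκ0 ht0) ht4) (by linear_combination -c₂)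
  have h13 : s 1 3 ^ 3 = κ * t 1 * t 3 := by
    rw [h02, h03, h12] at c₁
    exact mul_left_cancel₀ (mul_ne_zero (mul_ne_zero hκ0 ht0) ht2) (by linear_combination c₁)
  have h23 : s 2 3 ^ 3 = κ * t 2 * t 3 := by
    rw [h01, h03, h12] at c₄
    exact mul_left_cancel₀ (mul_ne_zero (mul_ne_zero hκ0 ht0) ht1) (by linear_combination c₄)
  have h24 : s 2 4 ^ 3 = κ * t 2 * t 4 := by
    rw [h13, h23, h14] at c₃
    exact mul_left_cancel₀ (mul_ne_zero (mul_ne_zero hκ0 ht1) ht3) (by linear_combination c₃)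
  have h34 : s 3 4 ^ 3 = κ * t 3 * t 4 := by
    rw [h12, h23, h14] at c₅
    exact mul_left_cancel₀ (mul_ne_zero (mul_ne_zero hκ0 ht1) ht2) (by linear_combination c₅)
  have hlt : ∀ i j : Fin 5, i < j → s i j ^ 3 = κ * t i * t j := by
    intro i j hij
    fin_cases i <;> fin_cases j <;> first | assumption | exact absurd hij (by decide)
  refine ⟨κ, hκ0, fun i j hij => ?_⟩
  rcases lt_or_gt_of_ne hij with h | h
  · exact hlt i j h
  · rw [hsymm, hlt j i h]; ring

/-- Criterion for 5-body Dziobek special central configurations on S³: q is an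
SCC iff the bodies do not lie in a common closed hemisphere, the five shape
equations hold, and the masses are proportional to the stated ratios.
Bodies are indexed 0,…,4. -/
theorem stmt18 (m : Fin 5 → ℝ) (q : Fin 5 → Fin 4 → ℝ)
    (hm : ∀ i, 0 < m i)
    (hunit : ∀ i, q i ⬝ᵥ q i = 1)
    (hns : ∀ i j, i ≠ j → q i ≠ q j ∧ q i ≠ -q j)
    (hspan : Submodule.span ℝ (Set.range q) = ⊤)
    (X : Matrix (Fin 4) (Fin 5) ℝ) (hX : ∀ r c, X r c = q c r)
    (Δ : Fin 5 → ℝ)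
    (hΔ : ∀ k, Δ k = (-1) ^ (k : ℕ) * (X.submatrix id (Fin.succAbove k)).det) :
    (∀ i, (∑ j ∈ Finset.univ.erase i,
        ((m i * m j) / (Real.sqrt (1 - (q i ⬝ᵥ q j) ^ 2)) ^ 3) •
          (q j - (q i ⬝ᵥ q j) • q i)) = 0) ↔
      ((¬ ∃ u : Fin 4 → ℝ, u ⬝ᵥ u = 1 ∧ ∀ i, 0 ≤ u ⬝ᵥ q i) ∧
        Real.sqrt (1 - (q 0 ⬝ᵥ q 2) ^ 2) * Real.sqrt (1 - (q 1 ⬝ᵥ q 3) ^ 2) =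
          Real.sqrt (1 - (q 0 ⬝ᵥ q 3) ^ 2) * Real.sqrt (1 - (q 1 ⬝ᵥ q 2) ^ 2) ∧
        Real.sqrt (1 - (q 0 ⬝ᵥ q 2) ^ 2) * Real.sqrt (1 - (q 1 ⬝ᵥ q 4) ^ 2) =
          Real.sqrt (1 - (q 0 ⬝ᵥ q 4) ^ 2) * Real.sqrt (1 - (q 1 ⬝ᵥ q 2) ^ 2) ∧
        Real.sqrt (1 - (q 1 ⬝ᵥ q 3) ^ 2) * Real.sqrt (1 - (q 2 ⬝ᵥ q 4) ^ 2) =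
          Real.sqrt (1 - (q 2 ⬝ᵥ q 3) ^ 2) * Real.sqrt (1 - (q 1 ⬝ᵥ q 4) ^ 2) ∧
        Real.sqrt (1 - (q 0 ⬝ᵥ q 1) ^ 2) * Real.sqrt (1 - (q 2 ⬝ᵥ q 3) ^ 2) =
          Real.sqrt (1 - (q 0 ⬝ᵥ q 3) ^ 2) * Real.sqrt (1 - (q 1 ⬝ᵥ q 2) ^ 2) ∧
        Real.sqrt (1 - (q 1 ⬝ᵥ q 2) ^ 2) * Real.sqrt (1 - (q 3 ⬝ᵥ q 4) ^ 2) =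
          Real.sqrt (1 - (q 2 ⬝ᵥ q 3) ^ 2) * Real.sqrt (1 - (q 1 ⬝ᵥ q 4) ^ 2) ∧
        m 0 = (Real.sqrt (1 - (q 0 ⬝ᵥ q 1) ^ 2)) ^ 3 * Δ 0 /
                ((Real.sqrt (1 - (q 1 ⬝ᵥ q 4) ^ 2)) ^ 3 * Δ 4) * m 4 ∧
        m 1 = (Real.sqrt (1 - (q 0 ⬝ᵥ q 1) ^ 2)) ^ 3 * Δ 1 /
                ((Real.sqrt (1 - (q 0 ⬝ᵥ q 4) ^ 2)) ^ 3 * Δ 4) * m 4 ∧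
        m 2 = (Real.sqrt (1 - (q 0 ⬝ᵥ q 2) ^ 2)) ^ 3 * Δ 2 /
                ((Real.sqrt (1 - (q 0 ⬝ᵥ q 4) ^ 2)) ^ 3 * Δ 4) * m 4 ∧
        m 3 = (Real.sqrt (1 - (q 0 ⬝ᵥ q 3) ^ 2)) ^ 3 * Δ 3 /
                ((Real.sqrt (1 - (q 0 ⬝ᵥ q 4) ^ 2)) ^ 3 * Δ 4) * m 4) := by
  obtain ⟨s, hs_def⟩ : ∃ s : Fin 5 → Fin 5 → ℝ,
      ∀ i j, Real.sqrt (1 - (q i ⬝ᵥ q j) ^ 2) = s i j := ⟨_, fun _ _ => rfl⟩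
  have hs : ∀ i j, i ≠ j → 0 < s i j := fun i j hij => by
    rw [← hs_def]
    exact Real.sqrt_pos.2 (one_sub_dotProduct_sq_pos (hunit i) (hunit j) (hns i j hij).1
      (hns i j hij).2)
  have hsymm : ∀ i j, s i j = s j i := fun i j => by
    rw [← hs_def, ← hs_def, dotProduct_comm]
  have hrel : ∑ k, Δ k • q k = 0 := by
    ext r
    simp only [Finset.sum_apply, Pi.smul_apply, smul_eq_mul, Pi.zero_apply, hΔ, ← hX]
    exact sum_minor_mul_eq_zero X r
  simp only [hs_def]
  constructor
  · intro h
    have hpow : ∀ i j, i ≠ j → 0 < s i j ^ 3 := fun i j hij => pow_pos (hs i j hij) 3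
    have hw : ∀ i j, i ≠ j → 0 < m i * m j / s i j ^ 3 := fun i j hij =>
      div_pos (mul_pos (hm i) (hm j)) (hpow i j hij)
    have hdet : ∀ j, (X.submatrix id (Fin.succAbove j)).det ≠ 0 := by
      intro j
      obtain ⟨i, hij⟩ := exists_ne j
      refine minor_ne_zero_of_relation hspan hX (relation_of_equilibrium (h i)) ?_
      rw [if_neg hij.symm]
      exact (hw i j hij).ne'
    have hΔ0 : ∀ j, Δ j ≠ 0 := fun j => by
      rw [hΔ]
      exact mul_ne_zero (pow_ne_zero _ (by norm_num)) (hdet j)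
    have hprop : ∀ i j k, j ≠ i → k ≠ i →
        m i * m j / s i j ^ 3 * Δ k = m i * m k / s i k ^ 3 * Δ j := by
      intro i j k hj hk
      have := relation_proportional hX (relation_of_equilibrium (h i)) hrel (hdet j) k
      rwa [if_neg hj, if_neg hk] at this
    have hcross : ∀ i j k, j ≠ i → k ≠ i → m j * s i k ^ 3 * Δ k = m k * s i j ^ 3 * Δ j := by
      intro i j k hj hk
      have h1 := hprop i j k hj hk
      have := (hm i).ne'
      have := (hs i j hj.symm).ne'
      have := (hs i k hk.symm).ne'
      field_simp at h1
      linear_combination h1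
    have hsign : ∀ j k, 0 < Δ j * Δ k := by
      intro j k
      obtain ⟨i, hij, hik⟩ : ∃ i : Fin 5, j ≠ i ∧ k ≠ i := by
        revert j k; decide
      have h1 := hprop i j k hij hik
      have h2 := hw i j hij.symm
      have h3 : 0 < m i * m k / s i k ^ 3 * (Δ j * Δ j) :=
        mul_pos (hw i k hik.symm) (mul_self_pos.2 (hΔ0 j))
      refine pos_of_mul_pos_right (a := m i * m j / s i j ^ 3) ?_ h2.le
      linarith [congrArg (· * Δ j) h1]
    have ht : ∀ i, m i / Δ i ≠ 0 := fun i => div_ne_zero (hm i).ne' (hΔ0 i)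
    have hrow : ∀ i j k, j ≠ i → k ≠ i →
        m j / Δ j * s i k ^ 3 = m k / Δ k * s i j ^ 3 := by
      intro i j k hj hk
      have := hΔ0 j
      have := hΔ0 k
      field_simp
      linear_combination hcross i j k hj hk
    have hshape : ∀ a b c d : Fin 5, a ≠ b → a ≠ c → d ≠ b → d ≠ c →
        s a b * s c d = s a c * s b d := fun a b c d hab hac hdb hdc =>
      shape_of_proportional hs hsymm (t := fun i => m i / Δ i) ht hrow hab hac hdb hdc
    have hmass : ∀ i j, j ≠ i → 4 ≠ i →
        m j = s i j ^ 3 * Δ j / (s i 4 ^ 3 * Δ 4) * m 4 := by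
      intro i j hj h4
      have := (hs i 4 h4.symm).ne'
      have := hΔ0 4
      field_simp
      linear_combination hcross i j 4 hj h4
    refine ⟨?_, ?_, ?_, ?_, ?_, ?_, ?_, ?_, ?_, ?_⟩
    · rintro ⟨u, hu1, hu⟩
      have h0 : ∑ k, Δ 0 * Δ k * (u ⬝ᵥ q k) = 0 := by
        have := congrArg (fun x => Δ 0 * (u ⬝ᵥ x)) hrel
        simpa [dotProduct_sum, dotProduct_smul, Finset.mul_sum, mul_assoc, -mul_eq_zero] using this
      have hz := (Finset.sum_eq_zero_iff_of_nonneg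
        (fun k _ => mul_nonneg (hsign 0 k).le (hu k))).1 h0
      have hu0 : u = 0 := eq_zero_of_dotProduct_span hspan fun i =>
        (mul_eq_zero.1 (hz i (Finset.mem_univ i))).resolve_left (hsign 0 i).ne'
      simp [hu0] at hu1
    · have := hshape 0 2 3 1 (by decide) (by decide) (by decide) (by decide)
      rw [hsymm 1 3, this, hsymm 1 2]
    · have := hshape 0 2 4 1 (by decide) (by decide) (by decide) (by decide)
      rw [hsymm 1 4, this, hsymm 1 2]
    · have := hshape 3 1 2 4 (by decide) (by decide) (by decide) (by decide)
      rw [hsymm 1 3, this, hsymm 2 3]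
    · have := hshape 0 1 3 2 (by decide) (by decide) (by decide) (by decide)
      rw [hsymm 2 3, this]
    · have := hshape 2 1 3 4 (by decide) (by decide) (by decide) (by decide)
      rw [hsymm 1 2, this]
    · have := hmass 1 0 (by decide) (by decide)
      rwa [hsymm 1 0] at this
    · exact hmass 0 1 (by decide) (by decide)
    · exact hmass 0 2 (by decide) (by decide)
    · exact hmass 0 3 (by decide) (by decide)
  · rintro ⟨-, e₁, e₂, e₃, e₄, e₅, f₀, f₁, f₂, f₃⟩ i
    have hnz : ∀ {x a b c d y : ℝ}, 0 < x → x = a * b / (c * d) * y → b ≠ 0 ∧ d ≠ 0 := by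
      intro x a b c d y hx h
      constructor <;> rintro rfl <;> simp [hx.ne'] at h
    have hΔ0 : ∀ j, Δ j ≠ 0 := by
      intro j
      fin_cases j
      · exact (hnz (hm 0) f₀).1
      · exact (hnz (hm 1) f₁).1
      · exact (hnz (hm 2) f₂).1
      · exact (hnz (hm 3) f₃).1
      · exact (hnz (hm 0) f₀).2
    have hratio : ∀ {x a b c d y : ℝ}, c ≠ 0 → b ≠ 0 → d ≠ 0 → x = a * b / (c * d) * y →
        x / b * c = a * (y / d) := by
      intro x a b c d y hc hb hd h
      rw [h]
      field_simp
    have h14 := (pow_pos (hs 1 4 (by decide)) 3).ne'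
    have h04 := (pow_pos (hs 0 4 (by decide)) 3).ne'
    have ht : ∀ i, m i / Δ i ≠ 0 := fun i => div_ne_zero (hm i).ne' (hΔ0 i)
    obtain ⟨κ, hκ, hrank⟩ := rank_one_of_shape hs hsymm (t := fun i => m i / Δ i) ht
      e₁ e₂ e₃ e₄ e₅
      (hratio h14 (hΔ0 0) (hΔ0 4) f₀) (hratio h04 (hΔ0 1) (hΔ0 4) f₁)
      (hratio h04 (hΔ0 2) (hΔ0 4) f₂) (hratio h04 (hΔ0 3) (hΔ0 4) f₃)
    have hterm : ∀ j ∈ Finset.univ.erase i,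
        (m i * m j / s i j ^ 3) • (q j - (q i ⬝ᵥ q j) • q i)
          = (Δ i / κ) • (Δ j • (q j - (q i ⬝ᵥ q j) • q i)) := by
      intro j hj
      have hi := (hm i).ne'
      have hj' := (hm j).ne'
      have hΔi := hΔ0 i
      have hΔj := hΔ0 j
      rw [hrank i j (Finset.ne_of_mem_erase hj).symm, smul_smul]
      congr 1
      field_simp
    rw [Finset.sum_congr rfl hterm, ← Finset.smul_sum,
      equilibrium_of_relation hrel (hunit i), smul_zero]
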